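/- arXiv:2007.11051 — 2 statements merged into one kernel-verified Lean document; each statement's English description precedes it below -/
import Mathlib

section
/- If T is a tree (a connected acyclic simple graph) on [N], then the number of D(T)-draconian sequences equals 2^{N−1}. (This is the connected case of the statement that a forest F on N vertices with k connected components satisfies NVol(∇^PQ_F) = 2^{N−k}.) -/
open Finset

attribute [local instance] Classical.propDecidable

/-- The set of neighbors of `i` in `G`, as a `Finset`. -/
noncomputable def nbr {N : ℕ} (G : SimpleGraph (Fin N)) (i : Fin N) : Finset (Fin N) :=
  Finset.univ.filter (fun j => G.Adj i j)

/-- `(a 1, …, a N)` is a `D(G)`-draconian sequence: the entries sum to `N - 1` and for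
every nonempty `S ⊆ [N]` one has `∑_{i ∈ S} a i < |S ∪ ⋃_{i ∈ S} N_G(i)|`. -/
def draconian {N : ℕ} (G : SimpleGraph (Fin N)) (a : Fin N → ℕ) : Prop :=
  (∑ i, a i) = N - 1 ∧
  ∀ S : Finset (Fin N), S.Nonempty →
    (∑ i ∈ S, a i) < (S ∪ S.biUnion (fun i => nbr G i)).card

section Draconian

variable {V W : Type} [Fintype V] [Fintype W]

/-- The union of the closed neighborhoods of the vertices in `S`. -/
noncomputable def closedNbr (G : SimpleGraph V) (S : Finset V) : Finset V :=
  Finset.univ.filter (fun v => ∃ i ∈ S, i = v ∨ G.Adj i v)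

/-- Draconian sequences indexed by an arbitrary finite vertex type. -/
def IsDraconian (G : SimpleGraph V) (a : V → ℕ) : Prop :=
  (∑ i, a i) + 1 = Fintype.card V ∧
  ∀ S : Finset V, S.Nonempty → (∑ i ∈ S, a i) < (closedNbr G S).card

lemma mem_closedNbr {G : SimpleGraph V} {S : Finset V} {v : V} :
    v ∈ closedNbr G S ↔ ∃ i ∈ S, i = v ∨ G.Adj i v := by
  simp [closedNbr]

lemma subset_closedNbr (G : SimpleGraph V) (S : Finset V) : S ⊆ closedNbr G S :=
  fun v hv => mem_closedNbr.2 ⟨v, hv, Or.inl rfl⟩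

lemma draconian_iff_isDraconian {N : ℕ} (hN : N ≠ 0) (G : SimpleGraph (Fin N))
    (a : Fin N → ℕ) : draconian G a ↔ IsDraconian G a := by
  have h : ∀ S : Finset (Fin N), S ∪ S.biUnion (fun i => nbr G i) = closedNbr G S := by
    intro S
    ext v
    simp only [mem_union, mem_biUnion, nbr, mem_filter, mem_univ, true_and, mem_closedNbr]
    grind
  simp only [draconian, IsDraconian, h, Fintype.card_fin]
  refine and_congr_left fun _ => ?_
  omega

lemma IsDraconian.comp_iso {G : SimpleGraph V} {H : SimpleGraph W} (e : G ≃g H)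
    {a : W → ℕ} (ha : IsDraconian H a) : IsDraconian G (a ∘ e) := by
  refine ⟨?_, fun S hS => ?_⟩
  · rw [Fintype.card_congr e.toEquiv, ← ha.1]
    congr 1
    exact Equiv.sum_comp e.toEquiv a
  · have h := ha.2 (S.map e.toEquiv.toEmbedding) (by simpa using hS)
    have hc : closedNbr H (S.map e.toEquiv.toEmbedding)
        = (closedNbr G S).map e.toEquiv.toEmbedding := by
      ext v
      obtain ⟨v, rfl⟩ := e.surjective v
      refine Iff.trans ?_ (mem_map' e.toEquiv.toEmbedding).symm
      suffices (∃ i ∈ S, i = v ∨ H.Adj (e i) (e v)) ↔ ∃ i ∈ S, i = v ∨ G.Adj i v by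
        simpa [mem_closedNbr, -mem_map_equiv]
      exact exists_congr fun i => and_congr_right fun _ => or_congr_right e.map_adj_iff
    rw [hc, card_map, sum_map] at h
    exact h

lemma encard_isDraconian_iso {G : SimpleGraph V} {H : SimpleGraph W} (e : G ≃g H) :
    {a | IsDraconian G a}.encard = {a | IsDraconian H a}.encard := by
  have h : {a | IsDraconian G a} = (fun a : W → ℕ => a ∘ e) '' {a | IsDraconian H a} := by
    ext a
    refine ⟨fun ha => ⟨a ∘ e.symm, ha.comp_iso e.symm, ?_⟩, ?_⟩
    · ext v
      simp
    · rintro ⟨b, hb, rfl⟩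
      exact IsDraconian.comp_iso e hb
  rw [h, (e.surjective.injective_comp_right).encard_image]

section Leaf

variable {G : SimpleGraph (Option W)} {p : W}

lemma card_closedNbr_map_some (hp : ∀ w, G.Adj none (some w) ↔ w = p) (S : Finset W) :
    (closedNbr G (S.map Function.Embedding.some)).card
      = (closedNbr (G.comap some) S).card + if p ∈ S then 1 else 0 := by
  split_ifs with h
  · rw [← card_insertNone]
    congr 1
    ext (_ | v) <;> simp [mem_closedNbr, G.adj_comm _ none, hp, h]
  · refine (congrArg card ?_).trans (card_map Function.Embedding.some)
    ext (_ | v) <;> simp [mem_closedNbr, G.adj_comm _ none, hp, h]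

lemma card_closedNbr_insertNone (hp : ∀ w, G.Adj none (some w) ↔ w = p) (S : Finset W) :
    (closedNbr G (insertNone S)).card
      = (insert p (closedNbr (G.comap some) S)).card + 1 := by
  rw [← card_insertNone]
  congr 1
  ext (_ | v) <;> simp [mem_closedNbr, Option.exists, hp]

lemma isDraconian_option_iff (hp : ∀ w, G.Adj none (some w) ↔ w = p) (a : Option W → ℕ) :
    IsDraconian G a ↔ a none + ∑ w, a (some w) = Fintype.card W ∧
      (∀ S : Finset W, S.Nonempty → ∑ w ∈ S, a (some w)
        < (closedNbr (G.comap some) S).card + if p ∈ S then 1 else 0) ∧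
      ∀ S : Finset W, a none + ∑ w ∈ S, a (some w)
        < (insert p (closedNbr (G.comap some) S)).card + 1 := by
  rw [IsDraconian, Fintype.sum_option, Fintype.card_option, add_left_inj]
  refine and_congr_right fun _ => ⟨fun h => ⟨fun S hS => ?_, fun S => ?_⟩, fun h S hS => ?_⟩
  · have := h (S.map Function.Embedding.some) (by simpa using hS)
    rwa [card_closedNbr_map_some hp, sum_map] at this
  · have := h (insertNone S) ⟨none, by simp⟩
    rwa [card_closedNbr_insertNone hp, sum_insertNone] at this
  · by_cases hn : none ∈ S
    · have := h.2 (eraseNone S)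
      rwa [← card_closedNbr_insertNone hp, ← sum_insertNone, insertNone_eraseNone,
        insert_eq_of_mem hn] at this
    · have hm : (eraseNone S).map Function.Embedding.some = S := by
        rw [map_some_eraseNone, erase_eq_of_notMem hn]
      have := h.1 (eraseNone S) (by rwa [← map_nonempty (f := Function.Embedding.some), hm])
      rw [← card_closedNbr_map_some hp, hm] at this
      rwa [← hm, sum_map, hm]

lemma isDraconian_elim_one_iff (hp : ∀ w, G.Adj none (some w) ↔ w = p) (b : W → ℕ) :
    IsDraconian G (fun o => o.elim 1 b) ↔ IsDraconian (G.comap some) b := by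
  rw [isDraconian_option_iff hp]
  simp only [Option.elim, IsDraconian, add_comm 1]
  refine and_congr_right fun _ => ⟨fun h S hS => ?_, fun h => ⟨fun S hS => ?_, fun S => ?_⟩⟩
  · by_cases hpS : p ∈ S
    · have := h.2 S
      rw [insert_eq_of_mem (subset_closedNbr _ _ hpS)] at this
      omega
    · simpa [hpS] using h.1 S hS
  · have := h S hS
    omega
  · obtain rfl | hS := S.eq_empty_or_nonempty
    · simp [closedNbr]
    · have := h S hS
      have := card_le_card (subset_insert p (closedNbr (G.comap some) S))
      omega

lemma isDraconian_elim_zero_iff (hp : ∀ w, G.Adj none (some w) ↔ w = p) (b : W → ℕ) :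
    IsDraconian G (fun o => o.elim 0 (b + Pi.single p 1)) ↔ IsDraconian (G.comap some) b := by
  rw [isDraconian_option_iff hp]
  simp only [Option.elim, IsDraconian, zero_add, Pi.add_apply, sum_add_distrib,
    sum_pi_single', mem_univ, if_true]
  refine and_congr_right fun _ => ⟨fun h S hS => ?_, fun h => ⟨fun S hS => ?_, fun S => ?_⟩⟩
  · have := h.1 S hS
    omega
  · have := h S hS
    omega
  · obtain rfl | hS := S.eq_empty_or_nonempty
    · simp
    · have := h S hS
      have := card_le_card (subset_insert p (closedNbr (G.comap some) S))
      split_ifs <;> omega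

lemma IsDraconian.leaf_cases (hp : ∀ w, G.Adj none (some w) ↔ w = p) {a : Option W → ℕ}
    (ha : IsDraconian G a) : a none = 1 ∨ a none = 0 ∧ a (some p) ≠ 0 := by
  rw [isDraconian_option_iff hp] at ha
  obtain ⟨hsum, hS, hT⟩ := ha
  have h1 := hT ∅
  simp only [sum_empty, add_zero, closedNbr, notMem_empty, false_and, exists_false,
    filter_false, insert_empty_eq, card_singleton] at h1
  by_contra! hcon
  have h0 : a none = 0 := by omega
  have hap := hcon.2 h0
  have hs : ∑ w ∈ univ.erase p, a (some w) = Fintype.card W := by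
    rw [sum_erase (f := fun w => a (some w)) _ hap]
    omega
  obtain he | hne := (univ.erase p).eq_empty_or_nonempty
  · rw [he, sum_empty] at hs
    exact (Fintype.card_pos_iff.2 ⟨p⟩).ne hs
  · have := hS _ hne
    have := card_le_univ (closedNbr (G.comap some) (univ.erase p))
    simp only [mem_erase, ne_eq, not_true_eq_false, false_and, if_false] at *
    omega

lemma encard_isDraconian_leaf (hp : ∀ w, G.Adj none (some w) ↔ w = p) :
    {a | IsDraconian G a}.encard = 2 * {b | IsDraconian (G.comap some) b}.encard := by
  set D := {b | IsDraconian (G.comap some) b}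
  let f : (W → ℕ) → Option W → ℕ := fun b o => o.elim 1 b
  let g : (W → ℕ) → Option W → ℕ := fun b o => o.elim 0 (b + Pi.single p 1)
  have hf : Function.Injective f := fun b c h => funext fun w => congrFun h (some w)
  have hg : Function.Injective g := fun b c h =>
    add_right_cancel (b := Pi.single p 1) (funext fun w => congrFun h (some w))
  have hD : {a | IsDraconian G a} = f '' D ∪ g '' D := by
    ext a
    constructor
    · intro ha
      rcases IsDraconian.leaf_cases hp ha with h | ⟨h, hne⟩
      · have hfa : f (fun w => a (some w)) = a := by
          ext (_ | w) <;> simp [f, h]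
        refine Or.inl ⟨_, ?_, hfa⟩
        exact (isDraconian_elim_one_iff hp _).1 (show IsDraconian G (f _) by rwa [hfa])
      · have hga : g ((fun w => a (some w)) - Pi.single p 1) = a := by
          ext (_ | w)
          · simp [g, h]
          · by_cases hw : w = p
            · subst hw
              simp [g]
              omega
            · simp [g, hw]
        refine Or.inr ⟨_, ?_, hga⟩
        exact (isDraconian_elim_zero_iff hp _).1 (show IsDraconian G (g _) by rwa [hga])
    · rintro (⟨b, hb, rfl⟩ | ⟨b, hb, rfl⟩)
      · exact (isDraconian_elim_one_iff hp b).2 hb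
      · exact (isDraconian_elim_zero_iff hp b).2 hb
  have hdisj : Disjoint (f '' D) (g '' D) := by
    rw [Set.disjoint_left]
    rintro _ ⟨b, -, rfl⟩ ⟨c, -, h⟩
    exact zero_ne_one (congrFun h none)
  rw [hD, Set.encard_union_eq hdisj, hf.encard_image, hg.encard_image, two_mul]

end Leaf

lemma encard_isDraconian_of_card_eq_one (G : SimpleGraph V) (hV : Fintype.card V = 1) :
    {a | IsDraconian G a}.encard = 1 := by
  rw [Set.encard_eq_one]
  refine ⟨0, Set.eq_singleton_iff_unique_mem.2 ⟨⟨by simp [hV], fun S hS => ?_⟩, ?_⟩⟩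
  · simpa using hS.mono (subset_closedNbr G S)
  · rintro a ⟨ha, -⟩
    have h : ∑ i, a i = 0 := by omega
    ext i
    exact (sum_eq_zero_iff.1 h) i (mem_univ i)

end Draconian

lemma encard_isDraconian_tree (n : ℕ) : ∀ (V : Type) [Fintype V] (G : SimpleGraph V),
    G.IsTree → Fintype.card V = n + 1 → {a | IsDraconian G a}.encard = 2 ^ n := by
  induction n with
  | zero =>
    intro V _ G _ hV
    simpa using encard_isDraconian_of_card_eq_one G hV
  | succ n ih =>
    intro V _ G hG hV
    have : Nontrivial V := Fintype.one_lt_card_iff_nontrivial.1 (by omega)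
    obtain ⟨l, hl⟩ := hG.exists_vert_degree_one_of_nontrivial
    obtain ⟨p, hlp, hp⟩ := SimpleGraph.degree_eq_one_iff_existsUnique_adj.1 hl
    let e : Option {v // v ≠ l} ≃ V := Equiv.optionSubtypeNe l
    have hadj : ∀ w, (G.comap e).Adj none (some w) ↔ w = ⟨p, hlp.ne'⟩ := by
      intro w
      rw [Subtype.ext_iff]
      exact ⟨fun h => hp _ h, fun h => by simpa [e, h] using hlp⟩
    have htree : ((G.comap e).comap some).IsTree :=
      ⟨hG.1.induce_compl_singleton_of_degree_eq_one hl, hG.2.induce {l}ᶜ⟩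
    have hcard : Fintype.card {v // v ≠ l} = n + 1 := by
      have := Fintype.card_congr e
      rw [Fintype.card_option] at this
      omega
    rw [← encard_isDraconian_iso (SimpleGraph.Iso.comap e G), encard_isDraconian_leaf hadj,
      ih _ _ htree hcard, pow_succ']

/-- If `T` is a tree (connected acyclic simple graph) on `[N]`, then the number of
`D(T)`-draconian sequences equals `2 ^ (N - 1)`. -/
theorem ncard_draconian_tree {N : ℕ} (T : SimpleGraph (Fin N)) (hT : T.IsTree) :
    {a : Fin N → ℕ | draconian T a}.ncard = 2 ^ (N - 1) := by
  have hN : N ≠ 0 := by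
    rintro rfl
    exact hT.1.nonempty.elim Fin.elim0
  simp only [draconian_iff_isDraconian hN, Set.ncard]
  rw [encard_isDraconian_tree (N - 1) _ T hT (by rw [Fintype.card_fin]; omega)]
  simp
end

section
/- Let G be a 2-connected simple graph on [N] and let e = uv be any edge of G. If (c_1,…,c_N) is a D(G∖e)-draconian sequence, then the sequence of length N+1 obtained from c by increasing the entry c_u by 1 and appending a final entry 0 is a D(G:e)-draconian sequence. Moreover, this map is an injection from 𝔇(G∖e) into 𝔇(G:e). -/
open Finset

attribute [local instance] Classical.propDecidable

/-- The subdivision `G : e` of the edge `e = uv` of `G`: the graph on `[N+1]` with edge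
set `(E(G) ∖ {uv}) ∪ {u(N+1), v(N+1)}`. -/
def subdiv {N : ℕ} (G : SimpleGraph (Fin N)) (u v : Fin N) : SimpleGraph (Fin (N + 1)) :=
  SimpleGraph.fromRel (fun i j =>
    (∃ a b : Fin N, i = a.castSucc ∧ j = b.castSucc ∧ G.Adj a b ∧
      ¬(a = u ∧ b = v) ∧ ¬(a = v ∧ b = u))
    ∨ (i = u.castSucc ∧ j = Fin.last N) ∨ (i = v.castSucc ∧ j = Fin.last N))

/-- The graph `G △ e` for an edge `e = uv` of `G`: the graph on `[N+1]` with edge set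
`E(G) ∪ {u(N+1), v(N+1)}`. -/
def triExt {N : ℕ} (G : SimpleGraph (Fin N)) (u v : Fin N) : SimpleGraph (Fin (N + 1)) :=
  SimpleGraph.fromRel (fun i j =>
    (∃ a b : Fin N, i = a.castSucc ∧ j = b.castSucc ∧ G.Adj a b)
    ∨ (i = u.castSucc ∧ j = Fin.last N) ∨ (i = v.castSucc ∧ j = Fin.last N))

/-- A graph on `[N]` is `2`-connected if it has at least `3` vertices, is connected, and
remains connected after deleting any single vertex. -/
def TwoConnected {N : ℕ} (G : SimpleGraph (Fin N)) : Prop :=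
  3 ≤ N ∧ G.Connected ∧
    ∀ v : Fin N, (G.comap (fun u : {w : Fin N // w ≠ v} => (u : Fin N))).Connected

theorem mem_closedNbr_iff {N : ℕ} (G : SimpleGraph (Fin N)) (S : Finset (Fin N)) (j : Fin N) :
    j ∈ S ∪ S.biUnion (fun i => nbr G i) ↔ j ∈ S ∨ ∃ i ∈ S, G.Adj i j := by
  simp [nbr]

theorem subdiv_adj_castSucc {N : ℕ} {G : SimpleGraph (Fin N)} {u v a b : Fin N}
    (h : (G.deleteEdges {s(u, v)}).Adj a b) :
    (subdiv G u v).Adj a.castSucc b.castSucc := by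
  simp only [SimpleGraph.deleteEdges_adj, Set.mem_singleton_iff, Sym2.eq_iff, not_or] at h
  refine (SimpleGraph.fromRel_adj _ _ _).2 ⟨?_, Or.inl (Or.inl ⟨a, b, rfl, rfl, h.1, h.2⟩)⟩
  simpa using h.1.ne

theorem subdiv_adj_last {N : ℕ} (G : SimpleGraph (Fin N)) (u v : Fin N) :
    (subdiv G u v).Adj u.castSucc (Fin.last N) :=
  (SimpleGraph.fromRel_adj _ _ _).2
    ⟨(Fin.castSucc_lt_last u).ne, Or.inl (Or.inr (Or.inl ⟨rfl, rfl⟩))⟩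

theorem sum_update_add_one {N : ℕ} (c : Fin N → ℕ) (u : Fin N) (S : Finset (Fin N)) :
    ∑ i ∈ S, Function.update c u (c u + 1) i = (∑ i ∈ S, c i) + if u ∈ S then 1 else 0 := by
  have h : ∀ i, Function.update c u (c u + 1) i = c i + if u = i then 1 else 0 := by
    intro i
    by_cases hi : u = i
    · subst hi; simp
    · simp [hi, Function.update_of_ne (Ne.symm hi)]
  simp [h, Finset.sum_add_distrib]

theorem sum_snoc_zero {N : ℕ} (d : Fin N → ℕ) (T : Finset (Fin (N + 1))) :
    ∑ i ∈ T, (Fin.snoc d 0 : Fin (N + 1) → ℕ) i =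
      ∑ i ∈ Finset.univ.filter (fun i : Fin N => i.castSucc ∈ T), d i := by
  rw [← Finset.univ_inter T, ← Finset.sum_ite_mem, Fin.sum_univ_castSucc, Finset.sum_filter]
  simp

theorem draconian_subdiv {N : ℕ} {G : SimpleGraph (Fin N)} {u v : Fin N} {c : Fin N → ℕ}
    (hc : draconian (G.deleteEdges {s(u, v)}) c) :
    draconian (subdiv G u v) (Fin.snoc (Function.update c u (c u + 1)) 0) := by
  obtain ⟨htot, hS⟩ := hc
  refine ⟨?_, fun T hT => ?_⟩
  · have hN : 0 < N := u.pos
    rw [sum_snoc_zero, sum_update_add_one]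
    simp only [Finset.mem_univ, Finset.filter_true, if_true, htot]
    omega
  · rw [sum_snoc_zero, sum_update_add_one]
    set S := Finset.univ.filter (fun i : Fin N => i.castSucc ∈ T) with hSdef
    have hmem : ∀ i, i ∈ S ↔ i.castSucc ∈ T := by simp [hSdef]
    rcases S.eq_empty_or_nonempty with h0 | hne
    · simpa [h0, -Finset.card_pos] using Finset.card_pos.2 (hT.mono Finset.subset_union_left)
    · set A := S ∪ S.biUnion (fun i => nbr (G.deleteEdges {s(u, v)}) i) with hA
      set B := T ∪ T.biUnion (fun i => nbr (subdiv G u v) i) with hB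
      have hsub : A.map Fin.castSuccEmb ⊆ B := by
        intro x hx
        obtain ⟨j, hj, rfl⟩ := Finset.mem_map.1 hx
        rw [hA, mem_closedNbr_iff] at hj
        rw [hB, mem_closedNbr_iff]
        rcases hj with hj | ⟨i, hi, hij⟩
        · exact Or.inl ((hmem j).1 hj)
        · exact Or.inr ⟨_, (hmem i).1 hi, subdiv_adj_castSucc hij⟩
      have hlt : ∑ i ∈ S, c i < A.card := hS S hne
      split_ifs with hu
      · have hlast : Fin.last N ∈ B := by
          rw [hB, mem_closedNbr_iff]
          exact Or.inr ⟨_, (hmem u).1 hu, subdiv_adj_last G u v⟩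
        have hnot : Fin.last N ∉ A.map Fin.castSuccEmb := by
          simp [Fin.castSucc_ne_last]
        have hcard := Finset.card_le_card (Finset.insert_subset hlast hsub)
        rw [Finset.card_insert_of_notMem hnot, Finset.card_map] at hcard
        omega
      · have hcard := Finset.card_le_card hsub
        rw [Finset.card_map] at hcard
        omega

theorem injective_snoc_update_add_one {N : ℕ} (u : Fin N) :
    Function.Injective (fun c : Fin N → ℕ =>
      (Fin.snoc (Function.update c u (c u + 1)) 0 : Fin (N + 1) → ℕ)) := by
  intro c d h
  funext i
  have hi := congrFun h i.castSucc
  simp only [Fin.snoc_castSucc] at hi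
  by_cases hu : i = u
  · subst hu; simpa using hi
  · simpa [hu] using hi

/-- Let `G` be `2`-connected on `[N]` with an edge `e = uv`. If `c` is `D(G∖e)`-draconian,
then the sequence obtained from `c` by increasing `c u` by `1` and appending a final `0` is
`D(G : e)`-draconian; moreover, this map is an injection from `𝔇(G∖e)` into `𝔇(G : e)`. -/
theorem draconian_update_snoc_zero_subdiv {N : ℕ} (G : SimpleGraph (Fin N))
    (h2 : TwoConnected G) (u v : Fin N) (he : G.Adj u v) :
    (∀ c : Fin N → ℕ, draconian (G.deleteEdges {s(u, v)}) c →
        draconian (subdiv G u v) (Fin.snoc (Function.update c u (c u + 1)) 0)) ∧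
    Set.InjOn
      (fun c : Fin N → ℕ =>
        (Fin.snoc (Function.update c u (c u + 1)) 0 : Fin (N + 1) → ℕ))
      {a | draconian (G.deleteEdges {s(u, v)}) a} := by
  exact ⟨fun c hc => draconian_subdiv hc, (injective_snoc_update_add_one u).injOn⟩
end
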